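/- Let Γ be a simple graph on n vertices. The number of ordered colorings of Γ using at most m colors, as a function of m, is the polynomial χ(Γ, m) = Σ_{α ⊨ n} ζ_α(Γ) · C(m, k(α)), where the sum is over compositions α of n, k(α) is the number of parts of α, and ζ_α(Γ) is the number of ordered colorings of type α. -/

import Mathlib

/-- `lam` is an ordered coloring of `G`: no two distinct vertices of the same
color are joined by a walk all of whose internal vertices have strictly smaller
colors. -/
def IsOrderedColoring {V C : Type*} [LinearOrder C] (G : SimpleGraph V)
    (lam : V → C) : Prop :=
  ∀ u v : V, u ≠ v → lam u = lam v →
    ¬ ∃ p : G.Walk u v, ∀ w ∈ p.support, w = u ∨ w = v ∨ lam w < lam u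

namespace IsOrderedColoring

theorem comp_iff {V C D : Type*} [LinearOrder C] [LinearOrder D] (G : SimpleGraph V)
    (lam : V → C) (e : C ↪o D) :
    IsOrderedColoring G (e ∘ lam) ↔ IsOrderedColoring G lam := by
  simp [IsOrderedColoring]

end IsOrderedColoring

theorem Fin.orderEmbedding_eq_of_range_eq {k l : ℕ} {D : Type*} [LinearOrder D]
    (e : Fin k ↪o D) (f : Fin l ↪o D) (h : Set.range e = Set.range f) :
    ∃ hkl : k = l, ∀ i, e i = f (Fin.cast hkl i) := by
  have hkl : k = l := by
    have := congrArg Set.ncard h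
    rwa [← Set.image_univ, ← Set.image_univ, Set.ncard_image_of_injective _ e.injective,
      Set.ncard_image_of_injective _ f.injective, Set.ncard_univ, Set.ncard_univ,
      Nat.card_fin, Nat.card_fin] at this
  subst hkl
  refine ⟨rfl, fun i => ?_⟩
  have := (StrictMono.range_inj e.strictMono f.strictMono).1 h
  simp [this]

theorem Fin.natCard_orderEmbedding (k m : ℕ) : Nat.card (Fin k ↪o Fin m) = m.choose k := by
  rw [Nat.card_congr Set.powersetCard.ofFinEmbEquiv, Set.powersetCard.card, Nat.card_fin]

theorem exists_composition_of_surjective {V : Type*} [Fintype V] {n k : ℕ}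
    (hn : Fintype.card V = n) (mu : V → Fin k) (hmu : Function.Surjective mu) :
    ∃ (α : Composition n) (h : α.length = k),
      ∀ j, Nat.card {v : V // mu v = Fin.cast h j} = α.blocksFun j := by
  refine ⟨⟨List.ofFn fun j => Nat.card {v : V // mu v = j}, ?_, ?_⟩, ?_, ?_⟩
  · intro i hi
    obtain ⟨j, rfl⟩ := (List.mem_ofFn' _ _).1 hi
    obtain ⟨v, hv⟩ := hmu j
    have : Nonempty {v : V // mu v = j} := ⟨⟨v, hv⟩⟩
    exact Nat.card_pos
  · rw [List.sum_ofFn, ← hn, ← Nat.card_eq_fintype_card, ← Nat.card_sigma]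
    exact Nat.card_congr (Equiv.sigmaFiberEquiv mu)
  · simp [Composition.length]
  · intro j
    simp [Composition.blocksFun, Fin.cast]

/-- Every ordered coloring factors uniquely as an ordered coloring whose fibers have the sizes prescribed
by a composition, followed by an order embedding. -/
theorem bijective_comp_of_composition {V : Type*} [Fintype V] (G : SimpleGraph V) {n : ℕ}
    (m : ℕ) (hn : Fintype.card V = n) :
    Function.Bijective (fun x : Σ α : Composition n,
        {lam : V → Fin α.length // IsOrderedColoring G lam ∧
          ∀ j : Fin α.length, Nat.card {v : V // lam v = j} = α.blocksFun j} ×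
          (Fin α.length ↪o Fin m) =>
      (⟨x.2.2 ∘ x.2.1.1, (IsOrderedColoring.comp_iff G _ _).2 x.2.1.2.1⟩ :
        {lam : V → Fin m // IsOrderedColoring G lam})) := by
  constructor
  · have surj : ∀ (α : Composition n) (mu : V → Fin α.length),
        (∀ j : Fin α.length, Nat.card {v : V // mu v = j} = α.blocksFun j) →
        Function.Surjective mu := fun α mu h j => by
      have hpos : 0 < Nat.card {v : V // mu v = j} := h j ▸ α.one_le_blocksFun j
      obtain ⟨⟨v, hv⟩⟩ := (Nat.card_pos_iff.1 hpos).1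
      exact ⟨v, hv⟩
    rintro ⟨α, ⟨mu, hmu, hα⟩, e⟩ ⟨β, ⟨nu, hnu, hβ⟩, f⟩ h
    have h : ∀ v, e (mu v) = f (nu v) := congrFun (congrArg Subtype.val h)
    obtain ⟨hkl, hef⟩ := Fin.orderEmbedding_eq_of_range_eq e f (by
      rw [← (surj α mu hα).range_comp, ← (surj β nu hβ).range_comp]
      exact congrArg Set.range (funext h))
    have hcast : ∀ v, Fin.cast hkl (mu v) = nu v := fun v => f.injective (by rw [← hef, h])
    obtain rfl : α = β := by
      refine Composition.ext (List.ext_get hkl fun i hi hi' => ?_)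
      refine (hα ⟨i, hi⟩).symm.trans (Eq.trans ?_ (hβ ⟨i, hi'⟩))
      simp only [← hcast, Fin.ext_iff, Fin.val_cast]
    obtain rfl : mu = nu := funext hcast
    obtain rfl : e = f := DFunLike.ext _ _ hef
    rfl
  · rintro ⟨lam, hlam⟩
    set s := Finset.univ.image lam with hs
    let e := s.orderEmbOfFin rfl
    have hmem : ∀ v, ∃ j, e j = lam v := fun v => by
      have : lam v ∈ Set.range e := by simp [e, hs]
      exact this
    choose mu hmu using hmem
    have hsurj : Function.Surjective mu := fun j => by
      have : e j ∈ s := Finset.orderEmbOfFin_mem _ _ _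
      obtain ⟨v, -, hv⟩ := Finset.mem_image.1 this
      exact ⟨v, e.injective ((hmu v).trans hv)⟩
    obtain ⟨α, hk, hα⟩ := exists_composition_of_surjective hn mu hsurj
    let c : Fin α.length ≃o Fin s.card := Fin.castOrderIso hk
    have hlam' : e ∘ mu = lam := funext hmu
    refine ⟨⟨α, ⟨c.symm ∘ mu, ?_, fun j => ?_⟩, c.toOrderEmbedding.trans e⟩, ?_⟩
    · rw [← hlam', IsOrderedColoring.comp_iff] at hlam
      exact (IsOrderedColoring.comp_iff G mu c.symm.toOrderEmbedding).2 hlam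
    · rw [← hα j]
      refine Nat.card_congr (Equiv.subtypeEquivRight fun v => ?_)
      exact c.symm_apply_eq
    · apply Subtype.ext
      funext v
      simp [hmu]

/-- The number of ordered colorings of a graph `Γ` on `n` vertices using at most
`m` colors equals `Σ_{α ⊨ n} ζ_α(Γ) · C(m, k(α))`, the sum over compositions `α`
of `n`, where `k(α)` is the number of parts and `ζ_α(Γ)` is the number of ordered
colorings of type `α`. -/
theorem orderedColorings_count_polynomial {V : Type*} [Fintype V]
    (G : SimpleGraph V) (n m : ℕ) (hn : Fintype.card V = n) :
    Nat.card {lam : V → Fin m // IsOrderedColoring G lam} =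
      ∑ α : Composition n,
        (Nat.card {lam : V → Fin α.length // IsOrderedColoring G lam ∧
          ∀ j : Fin α.length, Nat.card {v : V // lam v = j} = α.blocksFun j}) *
          m.choose α.length := by
  rw [← Nat.card_congr (Equiv.ofBijective _ (bijective_comp_of_composition G m hn)), Nat.card_sigma]
  simp only [Nat.card_prod, Fin.natCard_orderEmbedding]
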